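/- For every a ∈ (0,1/2], every p ≥ 1 and every r ∈ (0,1): (π/2)^{1-1/p} 𝒦_a(r^p)^{1/p} ≤ 𝒦_a(r) ≤ (π/2)^{1-p} 𝒦_a(r^{1/p})^p, and (π/2)^{1-p} ℰ_a(r^{1/p})^p ≤ ℰ_a(r) ≤ (π/2)^{1-1/p} ℰ_a(r^p)^{1/p}. -/

import Mathlib

open Real Set

/-- Shifted factorial (Pochhammer/Appell symbol) `(a)ₙ`. -/
noncomputable def shiftedFact (a : ℝ) : ℕ → ℝ
  | 0 => 1
  | n + 1 => shiftedFact a n * (a + n)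

/-- Gaussian hypergeometric function `F(a,b;c;x)` as a series. -/
noncomputable def hypF (a b c x : ℝ) : ℝ :=
  ∑' n : ℕ, shiftedFact a n * shiftedFact b n / (shiftedFact c n * (Nat.factorial n : ℝ)) * x ^ n

/-- Generalized complete elliptic integral of the first kind `𝒦ₐ(r)`. -/
noncomputable def ellK (a r : ℝ) : ℝ := (Real.pi / 2) * hypF a (1 - a) 1 (r ^ 2)

/-- Generalized complete elliptic integral of the second kind `ℰₐ(r)`. -/
noncomputable def ellE (a r : ℝ) : ℝ := (Real.pi / 2) * hypF (a - 1) (1 - a) 1 (r ^ 2)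

/-- The generalized Grötzsch modulus `μₐ(r)`. -/
noncomputable def muFn (a r : ℝ) : ℝ :=
  Real.pi / (2 * Real.sin (Real.pi * a)) * ellK a (Real.sqrt (1 - r ^ 2)) / ellK a r

/-- Inverse of `μₐ` (on `(0,1)`, where it is a decreasing homeomorphism onto `(0,∞)`). -/
noncomputable def muInv (a : ℝ) : ℝ → ℝ := Function.invFunOn (muFn a) (Set.Ioo 0 1)

/-- The generalized modular function `φ_K^a(r)`. -/
noncomputable def phiK (a K r : ℝ) : ℝ := muInv a (muFn a r / K)

/-- `η_K^a(x) = (s/s')²` where `s = φ_K^a(√(x/(1+x)))`. -/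
noncomputable def etaK (a K x : ℝ) : ℝ :=
  ((phiK a K (Real.sqrt (x / (1 + x)))) / Real.sqrt (1 - (phiK a K (Real.sqrt (x / (1 + x)))) ^ 2)) ^ 2

/-- `λₐ(K)`. -/
noncomputable def lambdaA (a K : ℝ) : ℝ :=
  (phiK a K (1 / Real.sqrt 2) / phiK a (1 / K) (1 / Real.sqrt 2)) ^ 2

/-- The generalized inverse hyperbolic tangent `artanh_p`. -/
noncomputable def artanhp (p x : ℝ) : ℝ := ∫ t in (0:ℝ)..x, (1 - t ^ p)⁻¹

/-- The inverse hyperbolic tangent. -/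
noncomputable def artanh (x : ℝ) : ℝ := (1 / 2) * Real.log ((1 + x) / (1 - x))

/-- Euler beta function. -/
noncomputable def betaB (x y : ℝ) : ℝ := Real.Gamma x * Real.Gamma y / Real.Gamma (x + y)

/-- `μ_{a,c}(r)`, the two-parameter generalized modulus. -/
noncomputable def muAC (a c r : ℝ) : ℝ :=
  betaB a (c - a) * hypF a (c - a) c (1 - r ^ 2) / (2 * hypF a (c - a) c (r ^ 2))

/-- Inverse of `μ_{a,c}` on `(0,1)`. -/
noncomputable def muACInv (a c : ℝ) : ℝ → ℝ := Function.invFunOn (muAC a c) (Set.Ioo 0 1)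

/-- The modular function `φ_K^{a,c}(r)`. -/
noncomputable def phiAC (a c K r : ℝ) : ℝ := muACInv a c (muAC a c r / K)

lemma sF_pos {a : ℝ} (ha : 0 < a) (n : ℕ) : 0 < shiftedFact a n := by
  induction n with
  | zero => simp [shiftedFact]
  | succ n ih => simp only [shiftedFact]; positivity

lemma sF_one (n : ℕ) : shiftedFact 1 n = (Nat.factorial n : ℝ) := by
  induction n with
  | zero => simp [shiftedFact]
  | succ n ih => simp only [shiftedFact, ih, Nat.factorial_succ]; push_cast; ring

lemma sF_shift (a : ℝ) (n : ℕ) : shiftedFact a (n + 1) = a * shiftedFact (a + 1) n := by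
  induction n with
  | zero => simp [shiftedFact]
  | succ n ih =>
    rw [shiftedFact, ih, shiftedFact]; push_cast; ring

noncomputable def hc (a b : ℝ) (n : ℕ) : ℝ :=
  shiftedFact a n * shiftedFact b n / (shiftedFact 1 n * (Nat.factorial n : ℝ))

lemma hc_zero (a b : ℝ) : hc a b 0 = 1 := by simp [hc, shiftedFact]

lemma hc_succ (a b : ℝ) (n : ℕ) :
    hc a b (n + 1) = hc a b n * ((a + n) * (b + n) / ((n + 1 : ℝ) ^ 2)) := by
  have h : (Nat.factorial n : ℝ) ≠ 0 := by positivity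
  have h2 : (n + 1 : ℝ) ≠ 0 := by positivity
  simp only [hc, sF_one, shiftedFact, Nat.factorial_succ]
  push_cast
  field_simp
  ring

lemma hc_shift (a b : ℝ) (n : ℕ) :
    hc a b (n + 1) = hc (a + 1) (b + 1) n * (a * b / ((n + 1 : ℝ) ^ 2)) := by
  have h : (Nat.factorial n : ℝ) ≠ 0 := by positivity
  have h2 : (n + 1 : ℝ) ≠ 0 := by positivity
  simp only [hc, sF_one]
  simp only [sF_shift, Nat.factorial_succ]
  push_cast
  field_simp

lemma hc_pos {a b : ℝ} (ha : 0 < a) (hb : 0 < b) (n : ℕ) : 0 < hc a b n := by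
  have := sF_pos ha n
  have := sF_pos hb n
  have := sF_pos one_pos n
  unfold hc; positivity

lemma hc_le_one {a b : ℝ} (ha : 0 < a) (hb : 0 < b)
    (h : ∀ n : ℕ, (a + n) * (b + n) ≤ (n + 1 : ℝ) ^ 2) (n : ℕ) : hc a b n ≤ 1 := by
  induction n with
  | zero => simp [hc_zero]
  | succ n ih =>
    rw [hc_succ]
    have h1 : (a + n) * (b + n) / ((n + 1 : ℝ) ^ 2) ≤ 1 := by
      rw [div_le_one (by positivity)]; exact h n
    exact mul_le_one₀ ih (by positivity) h1

lemma summ_of {c : ℕ → ℝ} (hb : ∀ n, |c n| ≤ 1) {x : ℝ} (h0 : 0 ≤ x) (h1 : x < 1) :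
    Summable (fun n => c n * x ^ n) := by
  refine Summable.of_norm_bounded (summable_geometric_of_lt_one h0 h1) (fun n => ?_)
  rw [Real.norm_eq_abs, abs_mul, abs_of_nonneg (pow_nonneg h0 n)]
  exact mul_le_of_le_one_left (pow_nonneg h0 n) (hb n)

lemma hypF_eq (a b x : ℝ) : hypF a b 1 x = ∑' n, hc a b n * x ^ n := rfl

section
variable {a : ℝ} (h0 : 0 < a) (h1 : a ≤ 1 / 2)
include h0 h1

lemma K_abs (n : ℕ) : |hc a (1 - a) n| ≤ 1 := by
  have hb : 0 < 1 - a := by linarith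
  rw [abs_of_pos (hc_pos h0 hb n)]
  refine hc_le_one h0 hb (fun n => ?_) n
  have : (0 : ℝ) ≤ n := by positivity
  nlinarith

lemma K_mono {x y : ℝ} (hx : 0 ≤ x) (hxy : x ≤ y) (hy : y < 1) :
    hypF a (1 - a) 1 x ≤ hypF a (1 - a) 1 y := by
  have hb : 0 < 1 - a := by linarith
  simp only [hypF_eq]
  refine Summable.tsum_le_tsum (fun n => ?_) (summ_of (K_abs h0 h1) hx (by linarith))
    (summ_of (K_abs h0 h1) (by linarith) hy)
  have := hc_pos h0 hb n
  gcongr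

lemma K_ge {x : ℝ} (hx : 0 ≤ x) (hy : x < 1) : 1 ≤ hypF a (1 - a) 1 x := by
  have hb : 0 < 1 - a := by linarith
  rw [hypF_eq]
  have := (summ_of (K_abs h0 h1) hx hy).le_tsum 0
    (fun n _ => mul_nonneg (hc_pos h0 hb n).le (pow_nonneg hx n))
  simpa [hc_zero] using this

lemma E_succ (n : ℕ) : hc (a - 1) (1 - a) (n + 1) =
    - (hc a (2 - a) n * ((1 - a) ^ 2 / ((n + 1 : ℝ) ^ 2))) := by
  rw [hc_shift]
  rw [show a - 1 + 1 = a by ring, show 1 - a + 1 = 2 - a by ring]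
  ring

lemma E_nonpos (n : ℕ) : hc (a - 1) (1 - a) (n + 1) ≤ 0 := by
  rw [E_succ h0 h1]
  have := hc_pos h0 (show 0 < 2 - a by linarith) n
  rw [neg_nonpos]; positivity

lemma E_abs (n : ℕ) : |hc (a - 1) (1 - a) n| ≤ 1 := by
  rcases n with _ | n
  · simp [hc_zero]
  rw [abs_of_nonpos (E_nonpos h0 h1 n), E_succ h0 h1, neg_neg]
  have h2 : 0 < 2 - a := by linarith
  have hle : hc a (2 - a) n ≤ 1 := by
    refine hc_le_one h0 h2 (fun n => ?_) n
    nlinarith [sq_nonneg (a - 1)]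
  refine mul_le_one₀ hle (by positivity) ?_
  rw [div_le_one (by positivity)]
  have : (0 : ℝ) ≤ n := by positivity
  nlinarith

lemma E_anti {x y : ℝ} (hx : 0 ≤ x) (hxy : x ≤ y) (hy : y < 1) :
    hypF (a - 1) (1 - a) 1 y ≤ hypF (a - 1) (1 - a) 1 x := by
  simp only [hypF_eq]
  refine Summable.tsum_le_tsum (fun n => ?_) (summ_of (E_abs h0 h1) (by linarith) hy)
    (summ_of (E_abs h0 h1) hx (by linarith))
  rcases n with _ | n
  · simp
  · exact mul_le_mul_of_nonpos_left (by gcongr) (E_nonpos h0 h1 n)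

lemma E_le {x : ℝ} (hx : 0 ≤ x) (hy : x < 1) : hypF (a - 1) (1 - a) 1 x ≤ 1 := by
  refine (E_anti h0 h1 le_rfl hx hy).trans (le_of_eq ?_)
  rw [hypF_eq, tsum_eq_single 0]
  · simp [hc_zero]
  · intro n hn; simp [hn]

lemma E_sum (n : ℕ) :
    ∑ k ∈ Finset.range (n + 1), hc (a - 1) (1 - a) k = hc a (2 - a) n := by
  induction n with
  | zero => simp [hc_zero]
  | succ n ih =>
    rw [Finset.sum_range_succ, ih, E_succ h0 h1, hc_succ]
    have h2 : (n + 1 : ℝ) ≠ 0 := by positivity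
    field_simp
    ring

lemma E_nonneg {x : ℝ} (hx : 0 ≤ x) (hy : x < 1) : 0 ≤ hypF (a - 1) (1 - a) 1 x := by
  rw [hypF_eq]
  have ht := (summ_of (E_abs h0 h1) hx hy).hasSum.tendsto_sum_nat
  refine ge_of_tendsto ht ?_
  filter_upwards [Filter.eventually_ge_atTop 1] with n hn
  obtain ⟨m, rfl⟩ : ∃ m, n = m + 1 := ⟨n - 1, by omega⟩
  refine (hc_pos h0 (show 0 < 2 - a by linarith) m).le.trans ?_
  rw [← E_sum h0 h1]
  refine Finset.sum_le_sum (fun k _ => ?_)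
  rcases k with _ | k
  · simp
  · have := E_nonpos h0 h1 k
    have := pow_le_one₀ hx hy.le (n := k + 1)
    nlinarith

end

lemma pull {C f q : ℝ} (hC : 0 < C) (hf : 0 ≤ f) : C ^ (1 - q) * (C * f) ^ q = C * f ^ q := by
  rw [Real.mul_rpow hC.le hf, ← mul_assoc, ← Real.rpow_add hC]
  simp

theorem stmt1 (a : ℝ) (ha : a ∈ Set.Ioc (0:ℝ) (1/2)) (p : ℝ) (hp : 1 ≤ p)
    (r : ℝ) (hr : r ∈ Set.Ioo (0:ℝ) 1) :
    (Real.pi / 2) ^ (1 - 1 / p) * (ellK a (r ^ p)) ^ (1 / p) ≤ ellK a r ∧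
    ellK a r ≤ (Real.pi / 2) ^ (1 - p) * (ellK a (r ^ (1 / p))) ^ p ∧
    (Real.pi / 2) ^ (1 - p) * (ellE a (r ^ (1 / p))) ^ p ≤ ellE a r ∧
    ellE a r ≤ (Real.pi / 2) ^ (1 - 1 / p) * (ellE a (r ^ p)) ^ (1 / p) := by
  obtain ⟨h0, h1⟩ := ha
  obtain ⟨r0, r1⟩ := hr
  have hC : 0 < Real.pi / 2 := by positivity
  have hp0 : 0 < p := by linarith
  have hq1 : 1 / p ≤ 1 := by rw [div_le_one hp0]; exact hp
  have hq0 : 0 < 1 / p := by positivity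
  have a1 : r ^ p ≤ r := Real.rpow_le_self_of_le_one r0.le r1.le hp
  have a0 : 0 ≤ r ^ p := Real.rpow_nonneg r0.le _
  have b1 : r ≤ r ^ (1 / p) := Real.self_le_rpow_of_le_one r0.le r1.le hq1
  have b0 : r ^ (1 / p) < 1 := Real.rpow_lt_one r0.le r1 hq0
  have A : (r ^ p) ^ 2 ≤ r ^ 2 := by gcongr
  have R : r ^ 2 < 1 := by nlinarith
  have B : r ^ 2 ≤ (r ^ (1 / p)) ^ 2 := by gcongr
  have B' : (r ^ (1 / p)) ^ 2 < 1 := by nlinarith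
  have A0 : 0 ≤ (r ^ p) ^ 2 := by positivity
  have B0 : 0 ≤ (r ^ (1 / p)) ^ 2 := by positivity
  have R0 : 0 ≤ r ^ 2 := by positivity
  have kA := K_ge h0 h1 A0 (A.trans_lt R)
  have kB := K_ge h0 h1 B0 B'
  have eA := E_nonneg h0 h1 A0 (A.trans_lt R)
  have eB := E_nonneg h0 h1 B0 B'
  simp only [ellK, ellE]
  rw [pull hC (by linarith), pull hC (by linarith), pull hC eA, pull hC eB]
  refine ⟨?_, ?_, ?_, ?_⟩ <;> apply mul_le_mul_of_nonneg_left _ hC.le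
  · exact (Real.rpow_le_self_of_one_le kA hq1).trans (K_mono h0 h1 A0 A R)
  · exact (K_mono h0 h1 R0 B B').trans (Real.self_le_rpow_of_one_le kB hp)
  · exact (Real.rpow_le_self_of_le_one eB (E_le h0 h1 B0 B') hp).trans (E_anti h0 h1 R0 B B')
  · exact (E_anti h0 h1 A0 A R).trans
      (Real.self_le_rpow_of_le_one eA (E_le h0 h1 A0 (A.trans_lt R)) hq1)
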